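/- Let κ > 0 and for each n let Z_n be a real-valued random variable with the standard normal law N(0, 1). Then R_n(Z_n) = O_p(n^{−3/2}): for every δ > 0 there exists K > 0 such that for all n ≥ 1, P( n^{3/2} · R_n(Z_n) > K ) ≤ δ. -/

import Mathlib

open MeasureTheory ProbabilityTheory Filter

/-- The confluent hypergeometric series `₁F₁(a; c; x)`. -/
noncomputable def oneF₁ (a c x : ℝ) : ℝ :=
  ∑' k : ℕ, (ascPochhammer ℝ k).eval a / ((ascPochhammer ℝ k).eval c * (k.factorial : ℝ)) * x ^ k

/-- The marginal likelihood ratio of the z-statistic under the normal-moment prior with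
`τ² = κn`. -/
noncomputable def Rz (κ : ℝ) (n : ℕ) (z : ℝ) : ℝ :=
  (1 + κ * n) ^ (-(3:ℝ)/2) * oneF₁ (3/2) (1/2) (κ * n * z^2 / (2 * (1 + κ * n)))

theorem ascPochhammer_eval_add_one_mul {R : Type*} [CommSemiring R] (a : R) (k : ℕ) :
    (ascPochhammer R k).eval (a + 1) * a = (ascPochhammer R k).eval a * (a + k) := by
  induction k with
  | zero => simp
  | succ k ih =>
    rw [ascPochhammer_succ_eval, mul_right_comm, ih, ascPochhammer_succ_eval]
    push_cast
    ring

theorem Real.hasSum_pow_div_factorial (x : ℝ) :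
    HasSum (fun k : ℕ => x ^ k / (k.factorial : ℝ)) (Real.exp x) := by
  rw [Real.exp_eq_exp_ℝ]
  exact NormedSpace.expSeries_div_hasSum_exp x

theorem Real.hasSum_natCast_mul_pow_div_factorial (x : ℝ) :
    HasSum (fun k : ℕ => k * (x ^ k / (k.factorial : ℝ))) (x * Real.exp x) := by
  rw [← hasSum_nat_add_iff' 1, Finset.sum_range_one, Nat.cast_zero, zero_mul, sub_zero]
  refine ((Real.hasSum_pow_div_factorial x).mul_left x).congr_fun fun k => ?_
  rw [Nat.factorial_succ]
  push_cast
  field_simp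
  ring

/-- `₁F₁(c + 1; c; x) = (1 + x / c) eˣ`. -/
theorem oneF₁_add_one {c : ℝ} (hc : 0 < c) (x : ℝ) :
    oneF₁ (c + 1) c x = (1 + x / c) * Real.exp x := by
  have h := (Real.hasSum_pow_div_factorial x).add
    ((Real.hasSum_natCast_mul_pow_div_factorial x).div_const c)
  rw [show (1 + x / c) * Real.exp x = Real.exp x + x * Real.exp x / c by ring, ← h.tsum_eq]
  refine tsum_congr fun k => ?_
  have hp := ascPochhammer_pos k c hc
  have he := ascPochhammer_eval_add_one_mul c k
  field_simp
  linear_combination x ^ k * he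

/-- The scaled likelihood ratio is bounded, uniformly in `n`, on bounded sets of `z`. -/
theorem rpow_mul_Rz_le {κ : ℝ} (hκ : 0 < κ) {n : ℕ} (hn : 1 ≤ n) {z M : ℝ} (hz : |z| ≤ M) :
    (n : ℝ) ^ ((3:ℝ)/2) * Rz κ n z ≤
      κ ^ (-(3:ℝ)/2) * ((1 + M ^ 2) * Real.exp (M ^ 2 / 2)) := by
  have hn' : (0 : ℝ) < n := by exact_mod_cast hn
  have hκn : 0 < κ * n := by positivity
  have hzM : z ^ 2 ≤ M ^ 2 := sq_le_sq' (abs_le.1 hz).1 (abs_le.1 hz).2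
  have harg : κ * n * z ^ 2 / (2 * (1 + κ * n)) ≤ M ^ 2 / 2 := by
    rw [div_le_div_iff₀ (by positivity) two_pos]
    nlinarith [mul_le_mul_of_nonneg_left hzM hκn.le, sq_nonneg M]
  have hpow : (n : ℝ) ^ ((3:ℝ)/2) * (1 + κ * n) ^ (-(3:ℝ)/2) ≤ κ ^ (-(3:ℝ)/2) := by
    calc (n : ℝ) ^ ((3:ℝ)/2) * (1 + κ * n) ^ (-(3:ℝ)/2)
        ≤ (n : ℝ) ^ ((3:ℝ)/2) * (κ * n) ^ (-(3:ℝ)/2) := by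
          gcongr ?_ * ?_
          exact Real.rpow_le_rpow_of_nonpos hκn (by linarith) (by norm_num)
      _ = κ ^ (-(3:ℝ)/2) := by
          rw [Real.mul_rpow hκ.le hn'.le, mul_left_comm, ← Real.rpow_add hn']
          norm_num
  have hF : oneF₁ (3/2) (1/2) (κ * n * z ^ 2 / (2 * (1 + κ * n))) ≤
      (1 + M ^ 2) * Real.exp (M ^ 2 / 2) := by
    rw [show (3 / 2 : ℝ) = 1 / 2 + 1 by norm_num, oneF₁_add_one (by norm_num)]
    gcongr
    linarith
  rw [Rz, ← mul_assoc]
  calc _ ≤ (n : ℝ) ^ ((3:ℝ)/2) * (1 + κ * n) ^ (-(3:ℝ)/2) *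
        ((1 + M ^ 2) * Real.exp (M ^ 2 / 2)) := by gcongr
    _ ≤ _ := by gcongr

theorem MeasureTheory.exists_measure_norm_gt_le {E : Type*} [NormedAddCommGroup E]
    [MeasurableSpace E] [BorelSpace E] [CompleteSpace E] [SecondCountableTopology E]
    (μ : Measure E) [IsFiniteMeasure μ] {ε : ENNReal} (hε : 0 < ε) :
    ∃ M : ℝ, μ {x | M < ‖x‖} ≤ ε := by
  obtain ⟨K, hK, hμ⟩ := isTightMeasureSet_iff_exists_isCompact_measure_compl_le.1
    (isTightMeasureSet_singleton (μ := μ)) ε hε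
  obtain ⟨M, hM⟩ := hK.isBounded.exists_norm_le
  exact ⟨M, (measure_mono fun x hx hxK => (hM x hxK).not_gt hx).trans (hμ μ rfl)⟩

/-- Under the null hypothesis (standard normal z-statistic), the marginal likelihood
ratio satisfies `R_n(Z_n) = O_p(n^{−3/2})`. -/
theorem Rz_null_Op (κ : ℝ) (hκ : 0 < κ)
    {Ω : Type*} [MeasureSpace Ω] [IsProbabilityMeasure (ℙ : Measure Ω)]
    (Z : ℕ → Ω → ℝ) (hZ : ∀ n, Measure.map (Z n) ℙ = gaussianReal 0 1) :
    ∀ δ : ℝ, 0 < δ → ∃ K : ℝ, 0 < K ∧ ∀ n : ℕ, 1 ≤ n →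
      ℙ {w | (n : ℝ) ^ ((3:ℝ)/2) * Rz κ n (Z n w) > K} ≤ ENNReal.ofReal δ := by
  intro δ hδ
  obtain ⟨M, hM⟩ := exists_measure_norm_gt_le (gaussianReal 0 1) (ENNReal.ofReal_pos.2 hδ)
  refine ⟨κ ^ (-(3:ℝ)/2) * ((1 + M ^ 2) * Real.exp (M ^ 2 / 2)), by positivity, fun n hn => ?_⟩
  have hmeas : AEMeasurable (Z n) ℙ :=
    aemeasurable_of_map_neZero (by rw [hZ n]; infer_instance)
  rw [← hZ n, Measure.map_apply_of_aemeasurable hmeas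
    (measurableSet_lt measurable_const measurable_norm)] at hM
  refine (measure_mono fun w hw => ?_).trans hM
  by_contra h
  exact (rpow_mul_Rz_le hκ hn (not_lt.1 h)).not_gt hw
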